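/- Let (M, I^M, c, d^M) be a fusion module over a fusion algebra (R, I^R, N, d^R), with I^R countable. The fusion module is amenable (i.e., ‖Γ_μ‖ = 1 for every probability measure μ on I^R) if and only if ‖Γ_u‖ = d^R(u) for every u ∈ R⁺ (elements with nonnegative coefficients). -/

import Mathlib

/-- A fusion module (with left action operators `Γ_v`, `‖Γ_v‖ ≤ d^R(v)`,
over a countable basis `I^R`) is amenable, i.e. `‖Γ_μ‖ = 1` for every probability measure
`μ` on `I^R` where `Γ_μ = ∑_v (μ(v)/d^R(v)) Γ_v`, if and only if `‖Γ_u‖ = d^R(u)` for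
every `u ∈ R⁺` (finitely supported nonnegative coefficients). -/
theorem stmt5 {IR : Type*} [Countable IR] {H : Type*} [NormedAddCommGroup H]
    [NormedSpace ℂ H] [CompleteSpace H]
    (dR : IR → ℝ) (hdR : ∀ v, 1 ≤ dR v)
    (Γ : IR → (H →L[ℂ] H)) (hΓ : ∀ v, ‖Γ v‖ ≤ dR v) :
    (∀ μ : IR → ℝ, (∀ v, 0 ≤ μ v) → Summable μ → (∑' v, μ v) = 1 →
        ‖∑' v, (μ v / dR v) • Γ v‖ = 1) ↔
    (∀ c : IR →₀ ℝ, (∀ v, 0 ≤ c v) →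
        ‖∑ v ∈ c.support, c v • Γ v‖ = ∑ v ∈ c.support, c v * dR v) := by
  classical
  have hpos : ∀ v, 0 < dR v := fun v => lt_of_lt_of_le one_pos (hdR v)
  constructor
  · intro h c hc
    by_cases hs : c.support = ∅
    · simp [hs]
    have hne : c.support.Nonempty := Finset.nonempty_iff_ne_empty.mpr hs
    set s : ℝ := ∑ v ∈ c.support, c v * dR v with hsdef
    have hspos : 0 < s := by
      refine Finset.sum_pos (fun v hv => ?_) hne
      exact mul_pos (lt_of_le_of_ne (hc v) (Ne.symm (Finsupp.mem_support_iff.mp hv))) (hpos v)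
    have hz : ∀ v, v ∉ c.support → c v * dR v / s = 0 := by
      intro v hv
      rw [Finsupp.notMem_support_iff.mp hv]; simp
    have key := h (fun v => c v * dR v / s)
      (fun v => div_nonneg (mul_nonneg (hc v) (hpos v).le) hspos.le)
      (summable_of_ne_finset_zero (s := c.support) (fun v hv => hz v hv))
      (by
        rw [tsum_eq_sum (s := c.support) (fun v hv => hz v hv), ← Finset.sum_div]
        exact div_self hspos.ne')
    have e : (∑' v, ((c v * dR v / s) / dR v) • Γ v) = s⁻¹ • ∑ v ∈ c.support, c v • Γ v := by
      rw [tsum_eq_sum (s := c.support) (fun v hv => by rw [hz v hv]; simp), Finset.smul_sum]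
      refine Finset.sum_congr rfl (fun v _ => ?_)
      rw [smul_smul]
      congr 1
      have := (hpos v).ne'
      field_simp
    rw [e, norm_smul, Real.norm_of_nonneg (inv_nonneg.mpr hspos.le)] at key
    field_simp at key
    exact key
  · intro h μ hμ hsum h1
    have hle : ∀ v, ‖(μ v / dR v) • Γ v‖ ≤ μ v := by
      intro v
      rw [norm_smul, Real.norm_of_nonneg (div_nonneg (hμ v) (hpos v).le)]
      calc μ v / dR v * ‖Γ v‖ ≤ μ v / dR v * dR v :=
            mul_le_mul_of_nonneg_left (hΓ v) (div_nonneg (hμ v) (hpos v).le)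
        _ = μ v := div_mul_cancel₀ _ (hpos v).ne'
    have hS : Summable (fun v => (μ v / dR v) • Γ v) := Summable.of_norm_bounded hsum hle
    have hfin : ∀ F : Finset IR, ‖∑ v ∈ F, (μ v / dR v) • Γ v‖ = ∑ v ∈ F, μ v := by
      intro F
      let c : IR →₀ ℝ := Finsupp.onFinset F (fun v => if v ∈ F then μ v / dR v else 0)
        (fun v hv => by by_contra hF; simp [hF] at hv)
      have hcv : ∀ v, c v = if v ∈ F then μ v / dR v else 0 := fun v => rfl
      have hsub : c.support ⊆ F := Finsupp.support_onFinset_subset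
      have hc := h c (fun v => by
        rw [hcv]; split_ifs
        · exact div_nonneg (hμ v) (hpos v).le
        · exact le_rfl)
      rw [Finset.sum_subset hsub (fun v _ hv => by
            rw [Finsupp.notMem_support_iff.mp hv, zero_smul]),
        Finset.sum_subset hsub (fun v _ hv => by
            rw [Finsupp.notMem_support_iff.mp hv, zero_mul])] at hc
      rw [Finset.sum_congr rfl (fun v hv => by rw [hcv, if_pos hv] :
            ∀ v ∈ F, c v • Γ v = (μ v / dR v) • Γ v),
        Finset.sum_congr rfl (fun v hv => by
            rw [hcv, if_pos hv, div_mul_cancel₀ _ (hpos v).ne'] :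
            ∀ v ∈ F, c v * dR v = μ v)] at hc
      exact hc
    have t1 := hS.hasSum.norm
    have t2 : Filter.Tendsto (fun F : Finset IR => ∑ v ∈ F, μ v) Filter.atTop (nhds 1) := by
      rw [← h1]; exact hsum.hasSum
    refine tendsto_nhds_unique (Filter.Tendsto.congr hfin t1) t2
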